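/- Let ε ∈ (0,1] and let Θ : [0,∞) → ℝ^{n×n} be a measurable function taking values in the diagonal matrices whose diagonal entries lie in [ε, 1]. Then there exists a class-KL function β such that every trajectory λ̃ : [0,∞) → ℝ^n of the form λ̃(t) = λ̃(0) − ∫₀ᵗ Θ(s) g(s) ds, where g : [0,∞) → ℝ^n is measurable and locally integrable with g(s) ∈ ∂f(λ̃(s)) for almost every s, satisfies dist(λ̃(t), Λ) ≤ β(dist(λ̃(0), Λ), t) for all t ≥ 0; i.e., the differential inclusion λ̃' ∈ −Θ(t) ∂f(λ̃) is uniformly globally asymptotically stable with respect to Λ. (Proposition 4) -/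

import Mathlib

open Filter Set
open scoped RealInnerProductSpace Topology

/-- A function whose increments are dominated by those of an absolutely continuous function is
absolutely continuous. -/
theorem AbsolutelyContinuousOnInterval.of_dist_le {X Y : Type*} [PseudoMetricSpace X]
    [PseudoMetricSpace Y] {u : ℝ → X} {p : ℝ → Y} {a b : ℝ}
    (hp : AbsolutelyContinuousOnInterval p a b)
    (h : ∀ x ∈ uIcc a b, ∀ y ∈ uIcc a b, dist (u x) (u y) ≤ dist (p x) (p y)) :
    AbsolutelyContinuousOnInterval u a b := by
  rw [absolutelyContinuousOnInterval_iff] at hp ⊢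
  intro ε hε
  obtain ⟨δ, hδ, H⟩ := hp ε hε
  refine ⟨δ, hδ, fun I hI hIδ => (Finset.sum_le_sum fun i hi => ?_).trans_lt (H I hI hIδ)⟩
  exact h _ (hI.1 i hi).1 _ (hI.1 i hi).2

/-- An absolutely continuous function whose derivative is almost everywhere at most `-c` decreases
at least at rate `c`. -/
theorem AbsolutelyContinuousOnInterval.add_mul_le {u : ℝ → ℝ} {a b c : ℝ} (hab : a ≤ b)
    (hu : AbsolutelyContinuousOnInterval u a b)
    (h : ∀ᵐ x, x ∈ Ioo a b → deriv u x ≤ -c) : u b + c * (b - a) ≤ u a := by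
  have h1 := hu.integral_deriv_eq_sub
  have h2 : ∫ x in a..b, deriv u x ≤ ∫ _ in a..b, -c := by
    refine intervalIntegral.integral_mono_ae_restrict hab hu.intervalIntegrable_deriv
      (by simp) ?_
    rw [← MeasureTheory.Measure.restrict_congr_set MeasureTheory.Ioo_ae_eq_Icc]
    exact (MeasureTheory.ae_restrict_iff' measurableSet_Ioo).2 h
  rw [intervalIntegral.integral_const, smul_eq_mul] at h2
  linarith

/-- Descent along the integral curve `lam' = -G`, for a convex function `f` with subgradients `g`
along the curve. -/
theorem ConvexOn.add_mul_le_of_integral_curve {E : Type*} [NormedAddCommGroup E]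
    [InnerProductSpace ℝ E] [FiniteDimensional ℝ E] {f : E → ℝ} (hf : ConvexOn ℝ univ f)
    {lam g G : ℝ → E} {a b c : ℝ} (hab : a ≤ b)
    (hG : IntervalIntegrable G MeasureTheory.volume a b)
    (hlam : ∀ t ∈ Icc a b, lam t = lam a - ∫ s in a..t, G s)
    (hg : ∀ᵐ s, s ∈ Ioo a b → ∀ m, f (lam s) + ⟪g s, m - lam s⟫ ≤ f m)
    (hc : ∀ᵐ s, s ∈ Ioo a b → c ≤ ⟪g s, G s⟫) :
    f (lam b) + c * (b - a) ≤ f (lam a) := by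
  have hsub : ∀ x ∈ Icc a b, ∀ y ∈ Icc a b, IntervalIntegrable G MeasureTheory.volume x y :=
    fun x hx y hy => hG.mono_set (by rw [uIcc_of_le hab]; exact uIcc_subset_Icc hx hy)
  have ha : a ∈ Icc a b := left_mem_Icc.2 hab
  have hcont : ContinuousOn lam (Icc a b) := by
    refine ContinuousOn.congr (f := fun t => lam a - ∫ s in a..t, G s) ?_ hlam
    refine continuousOn_const.sub ?_
    have := intervalIntegral.continuousOn_primitive_interval' hG left_mem_uIcc
    rwa [uIcc_of_le hab] at this
  obtain ⟨K, hK⟩ := LocallyLipschitzOn.exists_lipschitzOnWith_of_compact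
    (isCompact_Icc.image_of_continuousOn hcont)
    ((hf.locallyLipschitzOn isOpen_univ).mono (subset_univ _))
  have hac : AbsolutelyContinuousOnInterval (fun t => f (lam t)) a b := by
    refine AbsolutelyContinuousOnInterval.of_dist_le
      ((hG.norm.absolutelyContinuousOnInterval_intervalIntegral left_mem_uIcc).const_mul K) ?_
    rw [uIcc_of_le hab]
    intro x hx y hy
    refine (hK.dist_le_mul _ (mem_image_of_mem _ hx) _ (mem_image_of_mem _ hy)).trans ?_
    rw [Real.dist_eq, ← mul_sub, abs_mul, NNReal.abs_eq, dist_eq_norm,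
      intervalIntegral.integral_interval_sub_left (hsub a ha x hx).norm (hsub a ha y hy).norm,
      hlam x hx, hlam y hy, sub_sub_sub_cancel_left,
      intervalIntegral.integral_interval_sub_left (hsub a ha y hy) (hsub a ha x hx),
      intervalIntegral.integral_symm, norm_neg]
    gcongr
    exact intervalIntegral.norm_integral_le_abs_integral_norm
  refine hac.add_mul_le hab ?_
  filter_upwards [hg, hc, hac.ae_differentiableAt, hG.ae_hasDerivAt_integral]
    with s hgs hcs hds hGs hs
  have hsI := Ioo_subset_Icc_self hs
  rw [uIcc_of_le hab] at hds hGs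
  have hd : HasDerivAt lam (-G s) s := by
    refine HasDerivAt.congr_of_eventuallyEq ((hGs hsI a ha).const_sub (lam a)) ?_
    filter_upwards [Ioo_mem_nhds hs.1 hs.2] with t ht using hlam t (Ioo_subset_Icc_self ht)
  have hk : HasDerivAt (fun t => f (lam t) - ⟪g s, lam t⟫)
      (deriv (fun t => f (lam t)) s - ⟪g s, -G s⟫) s :=
    (hds hsI).hasDerivAt.sub (by simpa using (hasDerivAt_const s (g s)).inner ℝ hd)
  have hmin : IsLocalMin (fun t => f (lam t) - ⟪g s, lam t⟫) s := by
    refine Eventually.of_forall fun t => ?_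
    have := hgs hs (lam t)
    rw [inner_sub_right] at this
    simp only
    linarith
  have h0 := hmin.hasDerivAt_eq_zero hk
  have := hcs hs
  rw [inner_neg_right] at h0
  linarith
/-- The supremum of the values attained from time `t` on by the members of `S` starting from a
value at most `s`. -/
noncomputable def tailSup (S : Set (ℝ → ℝ)) (s t : ℝ) : ℝ :=
  sSup (insert 0 {x | ∃ d ∈ S, ∃ τ, 0 ≤ τ ∧ t ≤ τ ∧ d 0 ≤ s ∧ x = d τ})

theorem tailSup_le {S : Set (ℝ → ℝ)} {s t r : ℝ} (hr : 0 ≤ r)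
    (h : ∀ d ∈ S, d 0 ≤ s → ∀ τ, 0 ≤ τ → t ≤ τ → d τ ≤ r) : tailSup S s t ≤ r := by
  refine csSup_le (insert_nonempty _ _) ?_
  rintro x (rfl | ⟨d, hd, τ, hτ, htτ, hs, rfl⟩)
  · exact hr
  · exact h d hd hs τ hτ htτ

/-- Uniform boundedness, uniform stability and uniform attractivity of a family of nonnegative
functions yield a common class-`KL` bound. -/
theorem exists_classKL_bound (S : Set (ℝ → ℝ))
    (hbdd : ∀ s, ∃ R, ∀ d ∈ S, d 0 ≤ s → ∀ t, 0 ≤ t → d t ≤ R)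
    (hstab : ∀ η > 0, ∃ δ > 0, ∀ d ∈ S, d 0 ≤ δ → ∀ t, 0 ≤ t → d t ≤ η)
    (hattr : ∀ s, ∀ η > 0, ∃ T, ∀ d ∈ S, d 0 ≤ s → ∀ t, 0 ≤ t → T ≤ t → d t ≤ η)
    (hnonneg : ∀ d ∈ S, 0 ≤ d 0) :
    ∃ β : ℝ → ℝ → ℝ,
      (∀ t, ContinuousOn (fun s => β s t) (Ici 0) ∧
        StrictMonoOn (fun s => β s t) (Ici 0) ∧ β 0 t = 0) ∧
      (∀ s, AntitoneOn (fun t => β s t) (Ici 0) ∧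
        Tendsto (fun t => β s t) atTop (𝓝 0)) ∧
      ∀ d ∈ S, ∀ t, 0 ≤ t → d t ≤ β (d 0) t := by
  have hba : ∀ s t,
      BddAbove (insert 0 {x | ∃ d ∈ S, ∃ τ, 0 ≤ τ ∧ t ≤ τ ∧ d 0 ≤ s ∧ x = d τ}) := by
    intro s t
    obtain ⟨R, hR⟩ := hbdd s
    refine BddAbove.insert 0 ⟨R, ?_⟩
    rintro x ⟨d, hd, τ, hτ, -, hs, rfl⟩
    exact hR d hd hs τ hτ
  have hnn : ∀ s t, 0 ≤ tailSup S s t := fun s t => le_csSup (hba s t) (mem_insert _ _)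
  have hmono : ∀ t, Monotone fun s => tailSup S s t := by
    intro t s s' hss
    refine csSup_le_csSup (hba _ _) (insert_nonempty _ _) (insert_subset_insert ?_)
    rintro x ⟨d, hd, τ, hτ, htτ, hs, rfl⟩
    exact ⟨d, hd, τ, hτ, htτ, hs.trans hss, rfl⟩
  have hanti : ∀ s, Antitone fun t => tailSup S s t := by
    intro s t t' htt
    refine csSup_le_csSup (hba _ _) (insert_nonempty _ _) (insert_subset_insert ?_)
    rintro x ⟨d, hd, τ, hτ, htτ, hs, rfl⟩
    exact ⟨d, hd, τ, hτ, htt.trans htτ, hs, rfl⟩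
  have hzero : ∀ t, tailSup S 0 t = 0 := by
    intro t
    refine le_antisymm (le_of_forall_pos_le_add fun η hη => ?_) (hnn 0 t)
    obtain ⟨δ, hδ, H⟩ := hstab η hη
    rw [zero_add]
    exact tailSup_le hη.le fun d hd hd0 τ hτ _ => H d hd (hd0.trans hδ.le) τ hτ
  have hscale : ∀ s, 0 ≤ s → ∀ t, MonotoneOn (fun u => tailSup S (s * u) t) univ :=
    fun s hs t u _ v _ huv => hmono t (mul_le_mul_of_nonneg_left huv hs)
  have hint : ∀ s t, IntervalIntegrable (fun u => tailSup S (s * u) t) MeasureTheory.volume 1 2 := by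
    intro s t
    rcases le_total 0 s with hs | hs
    · exact ((hscale s hs t).mono (subset_univ _)).intervalIntegrable
    · exact AntitoneOn.intervalIntegrable fun u _ v _ huv =>
        hmono t (mul_le_mul_of_nonpos_left huv hs)
  have hle : ∀ s, 0 ≤ s → ∀ t, ∫ u in (1 : ℝ)..2, tailSup S (s * u) t ≤ tailSup S (s * 2) t := by
    intro s hs t
    have := intervalIntegral.integral_mono_on (by norm_num) (hint s t)
      (intervalIntegrable_const (c := tailSup S (s * 2) t)) fun u hu =>
        hscale s hs t (mem_univ u) (mem_univ 2) hu.2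
    simpa [show (2 : ℝ) - 1 = 1 by norm_num] using this
  have hge : ∀ s, 0 ≤ s → ∀ t, tailSup S s t ≤ ∫ u in (1 : ℝ)..2, tailSup S (s * u) t := by
    intro s hs t
    have := intervalIntegral.integral_mono_on (by norm_num)
      (intervalIntegrable_const (c := tailSup S (s * 1) t)) (hint s t) fun u hu =>
        hscale s hs t (mem_univ 1) (mem_univ u) hu.1
    simpa [show (2 : ℝ) - 1 = 1 by norm_num] using this
  have hpos : ∀ s t, 0 ≤ ∫ u in (1 : ℝ)..2, tailSup S (s * u) t := fun s t =>
    intervalIntegral.integral_nonneg (by norm_num) fun u _ => hnn _ _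
  have hlim : ∀ s, Tendsto (fun t => tailSup S s t) atTop (𝓝 0) := by
    intro s
    refine Metric.tendsto_atTop.2 fun η hη => ?_
    obtain ⟨T, hT⟩ := hattr s (η / 2) (half_pos hη)
    refine ⟨T, fun t ht => ?_⟩
    rw [Real.dist_0_eq_abs, abs_of_nonneg (hnn s t)]
    exact (tailSup_le (half_pos hη).le fun d hd hd0 τ hτ htτ =>
      hT d hd hd0 τ hτ (ht.trans htτ)).trans_lt (half_lt_self hη)
  have hcont : ∀ t, ContinuousOn (fun s => ∫ u in (1 : ℝ)..2, tailSup S (s * u) t) (Ici 0) := by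
    intro t s hs
    rcases (mem_Ici.1 hs).eq_or_lt with rfl | hs
    · refine Metric.continuousWithinAt_iff.2 fun η hη => ?_
      obtain ⟨δ, hδ, H⟩ := hstab (η / 2) (half_pos hη)
      refine ⟨δ / 2, half_pos hδ, fun {s} hs hsδ => ?_⟩
      rw [Real.dist_0_eq_abs, abs_of_nonneg hs] at hsδ
      simp only [zero_mul, hzero, intervalIntegral.integral_zero, Real.dist_0_eq_abs,
        abs_of_nonneg (hpos s t)]
      refine ((hle s hs t).trans (tailSup_le (half_pos hη).le fun d hd hd0 τ hτ _ =>
        H d hd (by linarith) τ hτ)).trans_lt (half_lt_self hη)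
    · refine ContinuousAt.continuousWithinAt ?_
      have hI : ∀ a b, IntervalIntegrable (fun σ => tailSup S σ t) MeasureTheory.volume a b :=
        fun a b => (hmono t).intervalIntegrable
      have hP := intervalIntegral.continuous_primitive hI 0
      have : ContinuousAt (fun s => s⁻¹ * ((∫ σ in (0 : ℝ)..(s * 2), tailSup S σ t) -
          ∫ σ in (0 : ℝ)..s, tailSup S σ t)) s :=
        (continuousAt_inv₀ hs.ne').mul
          ((hP.comp (continuous_mul_const 2)).sub hP).continuousAt
      refine this.congr ?_
      filter_upwards [lt_mem_nhds hs] with r hr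
      rw [intervalIntegral.integral_interval_sub_left (hI _ _) (hI _ _),
        intervalIntegral.integral_comp_mul_left (fun σ => tailSup S σ t) hr.ne', mul_one,
        smul_eq_mul]
  refine ⟨fun s t => if s < 0 then 0 else
    (∫ u in (1 : ℝ)..2, tailSup S (s * u) t) + s * Real.exp (-t), fun t => ⟨?_, ?_, ?_⟩,
    fun s => ⟨?_, ?_⟩, fun d hd t ht => ?_⟩
  · refine ((hcont t).add (continuous_mul_const (Real.exp (-t))).continuousOn).congr fun s hs => ?_
    simp [not_lt.2 (mem_Ici.1 hs)]
  · intro s hs s' hs' hss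
    simp only [not_lt.2 (mem_Ici.1 hs), not_lt.2 (mem_Ici.1 hs'), if_false]
    refine add_lt_add_of_le_of_lt ?_ (mul_lt_mul_of_pos_right hss (Real.exp_pos _))
    exact intervalIntegral.integral_mono_on (by norm_num) (hint s t) (hint s' t) fun u hu =>
      hmono t (mul_le_mul_of_nonneg_right hss.le (by linarith [hu.1]))
  · simp [hzero]
  · intro t _ t' _ htt
    by_cases hs : s < 0
    · simp [hs]
    · simp only [hs, if_false]
      have := intervalIntegral.integral_mono_on (by norm_num) (hint s t') (hint s t) fun u _ =>
        hanti (s * u) htt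
      have := not_lt.1 hs
      gcongr
  · by_cases hs : s < 0
    · simp [hs]
    · simp only [hs, if_false]
      have h1 : Tendsto (fun t => ∫ u in (1 : ℝ)..2, tailSup S (s * u) t) atTop (𝓝 0) :=
        squeeze_zero (hpos s) (hle s (not_lt.1 hs)) (hlim _)
      simpa using h1.add (Real.tendsto_exp_neg_atTop_nhds_zero.const_mul s)
  · have h0 := hnonneg d hd
    simp only [not_lt.2 h0, if_false]
    have h1 : d t ≤ tailSup S (d 0) t :=
      le_csSup (hba _ _) (mem_insert_of_mem _ ⟨d, hd, t, ht, le_rfl, le_rfl, rfl⟩)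
    have h2 := hge (d 0) h0 t
    have h3 := mul_nonneg h0 (Real.exp_pos (-t)).le
    linarith

/-- Quantitative comparison between a proper continuous function and the distance to its set of
minimizers. -/
theorem exists_infDist_comparison {E : Type*} [PseudoMetricSpace E] [ProperSpace E] [Nonempty E]
    {f : E → ℝ} (hf : Continuous f) (hrad : Tendsto f (Bornology.cobounded E) atTop) :
    IsCompact {x | ∀ y, f x ≤ f y} ∧ ∃ x₀, (∀ y, f x₀ ≤ f y) ∧
      (∀ s, ∃ M, ∀ x, Metric.infDist x {x | ∀ y, f x ≤ f y} ≤ s → f x ≤ M) ∧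
      (∀ M, ∃ R, ∀ x, f x ≤ M → Metric.infDist x {x | ∀ y, f x ≤ f y} ≤ R) ∧
      (∀ η > 0, ∃ v > 0, ∀ x, f x ≤ f x₀ + v →
        Metric.infDist x {x | ∀ y, f x ≤ f y} ≤ η) ∧
      (∀ v > 0, ∃ δ > 0, ∀ x, Metric.infDist x {x | ∀ y, f x ≤ f y} ≤ δ → f x ≤ f x₀ + v) := by
  obtain ⟨x₀, hx₀⟩ := hf.exists_forall_le (Metric.cobounded_eq_cocompact (α := E) ▸ hrad)
  set L := {x | ∀ y, f x ≤ f y} with hL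
  have hne : L.Nonempty := ⟨x₀, hx₀⟩
  have hsub : ∀ M, IsCompact {x | f x ≤ M} := by
    intro M
    refine Metric.isCompact_of_isClosed_isBounded (isClosed_le hf continuous_const) ?_
    have := hrad.eventually (eventually_gt_atTop M)
    refine (Bornology.isBounded_def.2 ?_)
    filter_upwards [this] with x hx using not_le.2 hx
  have hLeq : L = {x | f x ≤ f x₀} :=
    Set.ext fun x => ⟨fun h => h x₀, fun h y => le_trans h (hx₀ y)⟩
  have hLc : IsCompact L := hLeq ▸ hsub _
  have hthick : ∀ {s x}, 0 ≤ s → (x ∈ Metric.cthickening s L ↔ Metric.infDist x L ≤ s) := by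
    intro s x hs
    rw [Metric.mem_cthickening_iff, Metric.infDist,
      ENNReal.le_ofReal_iff_toReal_le (Metric.infEDist_ne_top hne) hs]
  refine ⟨hLc, x₀, hx₀, fun s => ?_, fun M => ?_, fun η hη => ?_, fun v hv => ?_⟩
  · obtain ⟨M, hM⟩ := (hLc.cthickening (r := max s 0)).bddAbove_image hf.continuousOn
    exact ⟨M, fun x hx => hM (mem_image_of_mem f
      ((hthick (le_max_right _ _)).2 (hx.trans (le_max_left _ _))))⟩
  · obtain ⟨R, hR⟩ := (hsub M).bddAbove_image (Metric.continuous_infDist_pt L).continuousOn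
    exact ⟨R, fun x hx => hR (mem_image_of_mem _ hx)⟩
  · by_contra! hcon
    have hK : IsCompact ({x | f x ≤ f x₀ + 1} ∩ {x | η ≤ Metric.infDist x L}) :=
      (hsub _).inter_right (isClosed_le continuous_const (Metric.continuous_infDist_pt L))
    obtain ⟨x₁, hx₁, hd₁⟩ := hcon 1 one_pos
    obtain ⟨z, hz, hzmin⟩ := hK.exists_isMinOn ⟨x₁, hx₁, hd₁.le⟩ hf.continuousOn
    have hzL : f x₀ < f z := by
      by_contra! h
      have : z ∈ L := hLeq ▸ h
      have h2 : η ≤ Metric.infDist z L := hz.2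
      rw [Metric.infDist_zero_of_mem this] at h2
      exact absurd h2 (not_le.2 hη)
    obtain ⟨x, hx, hd⟩ := hcon (min 1 ((f z - f x₀) / 2)) (lt_min one_pos (by linarith))
    have h1 := min_le_left 1 ((f z - f x₀) / 2)
    have h2 := min_le_right 1 ((f z - f x₀) / 2)
    have h3 : f z ≤ f x := hzmin ⟨by simp only [mem_ofPred_eq]; linarith, hd.le⟩
    linarith
  · obtain ⟨δ, hδ, H⟩ := hLc.exists_cthickening_subset_open
      (isOpen_lt hf continuous_const : IsOpen {x | f x < f x₀ + v})
      fun x hx => by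
        have := hx x₀
        simp only [mem_ofPred_eq]
        linarith
    exact ⟨δ, hδ, fun x hx => le_of_lt (H ((hthick hδ.le).2 hx))⟩

/-- **Proposition 4.** Let `f : ℝⁿ → ℝ` be convex and radially unbounded with minimizer set `Λ`.
For every measurable diagonal matrix function `Θ(t)` with diagonal entries in `[ε, 1]`,
the differential inclusion `λ̇ ∈ −Θ(t) ∂f(λ)` is uniformly globally asymptotically stable with
respect to `Λ`: there is a class-`KL` function `β` such that every (integral) trajectory
satisfies `dist(λ(t), Λ) ≤ β(dist(λ(0), Λ), t)`. -/
theorem ugas_of_subgradient_inclusion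
    {n : ℕ}
    (f : EuclideanSpace ℝ (Fin n) → ℝ)
    (hconv : ConvexOn ℝ Set.univ f)
    (hrad : Tendsto f (Bornology.cobounded (EuclideanSpace ℝ (Fin n))) atTop)
    (ε : ℝ) (hε0 : 0 < ε) (hε1 : ε ≤ 1)
    (Θ : ℝ → Fin n → ℝ)
    (hΘmeas : ∀ j, Measurable fun s => Θ s j)
    (hΘmem : ∀ s j, Θ s j ∈ Icc ε 1) :
    ∃ β : ℝ → ℝ → ℝ,
      -- β is of class KL
      (∀ t, ContinuousOn (fun s => β s t) (Ici 0) ∧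
        StrictMonoOn (fun s => β s t) (Ici 0) ∧ β 0 t = 0) ∧
      (∀ s, AntitoneOn (fun t => β s t) (Ici 0) ∧
        Tendsto (fun t => β s t) atTop (𝓝 0)) ∧
      -- every trajectory of the inclusion converges to Λ at rate β
      ∀ (lam : ℝ → EuclideanSpace ℝ (Fin n)) (g : ℝ → EuclideanSpace ℝ (Fin n)),
        (∀ j, Measurable fun s => g s j) →
        (∀ (T : ℝ) (j : Fin n),
          MeasureTheory.IntegrableOn (fun s => g s j) (Icc 0 T) MeasureTheory.volume) →
        (∀ᵐ s ∂(MeasureTheory.volume.restrict (Ici (0 : ℝ))),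
          ∀ m : EuclideanSpace ℝ (Fin n),
            f (lam s) + ⟪g s, m - lam s⟫ ≤ f m) →
        (∀ (t : ℝ) (j : Fin n), 0 ≤ t →
          lam t j = lam 0 j - ∫ s in (0 : ℝ)..t, Θ s j * g s j) →
        ∀ t : ℝ, 0 ≤ t →
          Metric.infDist (lam t) {x | ∀ y, f x ≤ f y} ≤
            β (Metric.infDist (lam 0) {x | ∀ y, f x ≤ f y}) t := by
  have hfc : Continuous f := continuousOn_univ.1 (hconv.locallyLipschitzOn isOpen_univ).continuousOn
  obtain ⟨hLc, x₀, hx₀, hC, hD, hE, hF⟩ := exists_infDist_comparison hfc hrad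
  set L := {x | ∀ y, f x ≤ f y} with hL
  have hne : L.Nonempty := ⟨x₀, hx₀⟩
  let S : Set (ℝ → ℝ) := {d | ∃ lam : ℝ → EuclideanSpace ℝ (Fin n),
    (∀ t, d t = Metric.infDist (lam t) L) ∧
    (∀ a b, 0 ≤ a → a ≤ b → f (lam b) ≤ f (lam a)) ∧
    ∀ t v R, 0 ≤ t → 0 < v → 0 < R → (∀ τ ∈ Icc 0 t, f x₀ + v ≤ f (lam τ)) →
      (∀ τ ∈ Icc 0 t, Metric.infDist (lam τ) L ≤ R) →
      f (lam t) + ε * (v / R) ^ 2 * t ≤ f (lam 0)}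
  obtain ⟨β, h1, h2, h3⟩ : ∃ β : ℝ → ℝ → ℝ,
      (∀ t, ContinuousOn (fun s => β s t) (Ici 0) ∧
        StrictMonoOn (fun s => β s t) (Ici 0) ∧ β 0 t = 0) ∧
      (∀ s, AntitoneOn (fun t => β s t) (Ici 0) ∧
        Tendsto (fun t => β s t) atTop (𝓝 0)) ∧
      ∀ d ∈ S, ∀ t, 0 ≤ t → d t ≤ β (d 0) t := by
    refine exists_classKL_bound S ?_ ?_ ?_ ?_
    · intro s
      obtain ⟨M, hM⟩ := hC s
      obtain ⟨R, hR⟩ := hD M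
      refine ⟨R, ?_⟩
      rintro d ⟨lam, hd, hmono, -⟩ hs t ht
      rw [hd] at hs ⊢
      exact hR _ ((hmono 0 t le_rfl ht).trans (hM _ hs))
    · intro η hη
      obtain ⟨v, hv, H⟩ := hE η hη
      obtain ⟨δ, hδ, H'⟩ := hF v hv
      refine ⟨δ, hδ, ?_⟩
      rintro d ⟨lam, hd, hmono, -⟩ hs t ht
      rw [hd] at hs ⊢
      exact H _ ((hmono 0 t le_rfl ht).trans (H' _ hs))
    · intro s η hη
      obtain ⟨v, hv, H⟩ := hE η hη
      obtain ⟨M, hM⟩ := hC s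
      obtain ⟨R, hR⟩ := hD M
      have hRpos : 0 < max R 1 := lt_max_of_lt_right one_pos
      have hrate : 0 < ε * (v / max R 1) ^ 2 := by positivity
      refine ⟨(M - f x₀) / (ε * (v / max R 1) ^ 2), ?_⟩
      rintro d ⟨lam, hd, hmono, hdec⟩ hs t ht hTt
      rw [hd] at hs ⊢
      by_contra! hcon
      have hft : f x₀ + v < f (lam t) := by
        by_contra! h
        exact absurd (H _ h) (not_le.2 hcon)
      have := hdec t v (max R 1) ht hv hRpos (fun τ hτ => hft.le.trans (hmono τ t hτ.1 hτ.2))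
        fun τ hτ => (hR _ ((hmono 0 τ le_rfl hτ.1).trans (hM _ hs))).trans (le_max_left _ _)
      have h0 := hM _ hs
      rw [div_le_iff₀ hrate] at hTt
      linarith
    · rintro d ⟨lam, hd, -⟩
      rw [hd]
      exact Metric.infDist_nonneg
  refine ⟨β, h1, h2, fun lam g hgm hgi hgs hlam => ?_⟩
  let G : ℝ → EuclideanSpace ℝ (Fin n) := fun s => WithLp.toLp 2 fun j => Θ s j * g s j
  have hGi : ∀ a b, 0 ≤ a → a ≤ b → IntervalIntegrable G MeasureTheory.volume a b := by
    intro a b ha hab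
    rw [intervalIntegrable_iff_integrableOn_Icc_of_le hab]
    refine MeasureTheory.Integrable.of_eval_piLp fun j => ?_
    refine MeasureTheory.Integrable.bdd_mul (c := 1)
      ((hgi b j).mono_set (Icc_subset_Icc_left ha)) (hΘmeas j).aestronglyMeasurable
      (Eventually.of_forall fun s => ?_)
    rw [Real.norm_eq_abs, abs_of_nonneg (hε0.le.trans (hΘmem s j).1)]
    exact (hΘmem s j).2
  have hlam0 : ∀ t, 0 ≤ t → lam t = lam 0 - ∫ s in (0 : ℝ)..t, G s := by
    intro t ht
    ext j
    have := (EuclideanSpace.proj (𝕜 := ℝ) j).intervalIntegral_comp_comm (hGi 0 t le_rfl ht)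
    rw [hlam t j ht]
    simp only [PiLp.sub_apply, sub_right_inj]
    exact this
  have hlamab : ∀ a b, 0 ≤ a → ∀ t ∈ Icc a b, lam t = lam a - ∫ s in a..t, G s := by
    intro a b ha t ht
    rw [hlam0 t (ha.trans ht.1), hlam0 a ha, ← intervalIntegral.integral_add_adjacent_intervals
      (hGi 0 a le_rfl ha) (hGi a t ha ht.1)]
    abel
  have hgs' : ∀ᵐ s, 0 ≤ s → ∀ m, f (lam s) + ⟪g s, m - lam s⟫ ≤ f m :=
    (MeasureTheory.ae_restrict_iff' measurableSet_Ici).1 hgs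
  have hin : ∀ s, ε * ‖g s‖ ^ 2 ≤ ⟪g s, G s⟫ := by
    intro s
    rw [EuclideanSpace.norm_sq_eq, PiLp.inner_apply, Finset.mul_sum]
    refine Finset.sum_le_sum fun j _ => ?_
    have h := mul_le_mul_of_nonneg_right (hΘmem s j).1 (sq_nonneg (g s j))
    simp only [G, Real.norm_eq_abs, sq_abs, RCLike.inner_apply, conj_trivial]
    linarith
  refine h3 (fun t => Metric.infDist (lam t) L) ⟨lam, fun _ => rfl, fun a b ha hab => ?_,
    fun t v R ht hv hR hfv hdR => ?_⟩
  · have := hconv.add_mul_le_of_integral_curve (c := 0) hab (hGi a b ha hab) (hlamab a b ha)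
      (hgs'.mono fun s hs hsI => hs (ha.trans hsI.1.le))
      (Eventually.of_forall fun s _ => le_trans (by positivity) (hin s))
    simpa using this
  · have := hconv.add_mul_le_of_integral_curve (c := ε * (v / R) ^ 2) ht (hGi 0 t le_rfl ht)
      (hlamab 0 t le_rfl) (hgs'.mono fun s hs hsI => hs hsI.1.le)
      (hgs'.mono fun s hs hsI => ?_)
    · simpa using this
    · refine le_trans ?_ (hin s)
      have hsI' := Ioo_subset_Icc_self hsI
      obtain ⟨y, hy, hyd⟩ := hLc.exists_infDist_eq_dist hne (lam s)
      have e1 := hs hsI.1.le y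
      have e2 := abs_le.1 (abs_real_inner_le_norm (g s) (y - lam s))
      have e3 : ‖y - lam s‖ ≤ R := by
        rw [← dist_eq_norm, dist_comm, ← hyd]
        exact hdR s hsI'
      have e4 := mul_le_mul_of_nonneg_left e3 (norm_nonneg (g s))
      have e5 := hfv s hsI'
      have e6 := hy x₀
      have : v / R ≤ ‖g s‖ := by
        rw [div_le_iff₀ hR]
        linarith [e2.1]
      gcongr
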